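/- arXiv:2303.03782 — 2 statements merged into one kernel-verified Lean document; each statement's English description precedes it below -/
import Mathlib

section
/- Let θ > 0 and α ∈ (−θ, 1). The space G_α is stable under the operator S, and S : G_α → G_α is Lipschitz with constant c(α,θ) = Γ(1−α)Γ(α+θ)/Γ(θ) for the norm ‖·‖_{G_α}: for all measurable F₁, F₂ : I_≤* → [0,1] with finite G_α-norm, ‖S(F₁) − S(F₂)‖_{G_α} ≤ c(α,θ) ‖F₁ − F₂‖_{G_α}. -/
open MeasureTheory Real Set

/-- The set `I_≤* = {(s₁,s₂) ∈ (0,∞)² : s₁ ≤ s₂}`. -/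
def Ile : Set (ℝ × ℝ) := {p | 0 < p.1 ∧ p.1 ≤ p.2}

/-- The two-point operator `S` from the integral equation for crossing
probabilities. -/
noncomputable def S (θ : ℝ) (F : ℝ × ℝ → ℝ) : ℝ × ℝ → ℝ :=
  fun p => 1 - (1 - p.1 / p.2) ^ θ +
    θ * (p.2 / p.1 - 1) ^ θ *
      ∫ t in Ioi (1 : ℝ), (p.2 / p.1 + t - 1) ^ (-θ - 1) * F ((p.2 - p.1) / t, p.2 - p.1)

/-- Membership in the space `G_α`: `F` is measurable, takes values in `[0,1]` on
`I_≤*`, and `sup_{(s₁,s₂) ∈ I_≤*} (s₂/s₁)^α |F(s₁,s₂)| < ∞`. -/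
def MemG (α : ℝ) (F : ℝ × ℝ → ℝ) : Prop :=
  Measurable F ∧ (∀ p ∈ Ile, F p ∈ Icc (0 : ℝ) 1) ∧
    BddAbove ((fun p : ℝ × ℝ => (p.2 / p.1) ^ α * |F p|) '' Ile)

/-- The norm `‖F‖_{G_α} = sup_{(s₁,s₂) ∈ I_≤*} (s₂/s₁)^α |F(s₁,s₂)|`. -/
noncomputable def normG (α : ℝ) (F : ℝ × ℝ → ℝ) : ℝ :=
  sSup ((fun p : ℝ × ℝ => (p.2 / p.1) ^ α * |F p|) '' Ile)


theorem lintegral_rpow_mul_exp_neg_mul_Ioi {a r : ℝ} (ha : 0 < a) (hr : 0 < r) :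
    ∫⁻ t in Ioi (0 : ℝ), ENNReal.ofReal (t ^ (a - 1) * exp (-(r * t))) =
      ENNReal.ofReal ((1 / r) ^ a * Gamma a) := by
  rw [← integral_rpow_mul_exp_neg_mul_Ioi ha hr, ofReal_integral_eq_lintegral_ofReal]
  · have h := integrableOn_rpow_mul_exp_neg_mul_rpow (p := 1) (s := a - 1) (b := r)
      (by linarith) one_pos hr
    simpa [IntegrableOn] using h
  · filter_upwards [ae_restrict_mem measurableSet_Ioi] with t ht
    have : 0 < t := ht
    simp only [Pi.zero_apply]
    positivity

theorem lintegral_add_rpow_mul_rpow_Ioi {θ α x : ℝ} (hθ : 0 < θ) (hα : α ∈ Ioo (-θ) 1)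
    (hx : 0 < x) :
    ∫⁻ t in Ioi (0 : ℝ), ENNReal.ofReal ((x + t) ^ (-θ - 1) * t ^ (-α)) =
      ENNReal.ofReal (x ^ (-θ - α) * (Gamma (1 - α) * Gamma (α + θ) / Gamma (θ + 1))) := by
  obtain ⟨h1, h2⟩ := hα
  have hG : 0 < Gamma (θ + 1) := Gamma_pos_of_pos (by linarith)
  have hG1 : 0 < Gamma (1 - α) := Gamma_pos_of_pos (by linarith)
  have hswap := lintegral_lintegral_swap (μ := volume.restrict (Ioi (0 : ℝ)))
    (ν := volume.restrict (Ioi (0 : ℝ)))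
    (f := fun t s => ENNReal.ofReal (t ^ (-α) * s ^ θ * exp (-((x + t) * s))))
    (Measurable.aemeasurable (by unfold Function.uncurry; fun_prop))
  have hleft : ∀ t ∈ Ioi (0 : ℝ),
      ∫⁻ s in Ioi (0 : ℝ), ENNReal.ofReal (t ^ (-α) * s ^ θ * exp (-((x + t) * s))) =
        ENNReal.ofReal (Gamma (θ + 1)) *
          ENNReal.ofReal ((x + t) ^ (-θ - 1) * t ^ (-α)) := by
    intro t ht
    have ht : 0 < t := ht
    have h := lintegral_rpow_mul_exp_neg_mul_Ioi (a := θ + 1) (r := x + t) (by linarith)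
      (by linarith)
    rw [add_sub_cancel_right] at h
    have ht' : 0 ≤ t ^ (-α) := by positivity
    simp_rw [mul_assoc, ENNReal.ofReal_mul ht']
    rw [lintegral_const_mul _ (by fun_prop), h, ← ENNReal.ofReal_mul ht',
      ← ENNReal.ofReal_mul hG.le]
    congr 1
    rw [one_div, inv_rpow (by linarith), ← rpow_neg (by linarith), neg_add']
    ring
  have hright : ∀ s ∈ Ioi (0 : ℝ),
      ∫⁻ t in Ioi (0 : ℝ), ENNReal.ofReal (t ^ (-α) * s ^ θ * exp (-((x + t) * s))) =
        ENNReal.ofReal (Gamma (1 - α)) *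
          ENNReal.ofReal (s ^ (α + θ - 1) * exp (-(x * s))) := by
    intro s hs
    have hs : 0 < s := hs
    have h := lintegral_rpow_mul_exp_neg_mul_Ioi (a := 1 - α) (r := s) (by linarith) hs
    have hc : 0 ≤ s ^ θ * exp (-(x * s)) := by positivity
    have he : ∀ t : ℝ, t ^ (-α) * s ^ θ * exp (-((x + t) * s)) =
        (s ^ θ * exp (-(x * s))) * (t ^ (1 - α - 1) * exp (-(s * t))) := by
      intro t
      rw [show -((x + t) * s) = -(x * s) + -(s * t) by ring, exp_add,
        show 1 - α - 1 = -α by ring]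
      ring
    simp_rw [he, ENNReal.ofReal_mul hc]
    rw [lintegral_const_mul _ (by fun_prop), h, ← ENNReal.ofReal_mul hc,
      ← ENNReal.ofReal_mul hG1.le]
    congr 1
    rw [one_div, inv_rpow hs.le, ← rpow_neg hs.le,
      show α + θ - 1 = θ + -(1 - α) by ring, rpow_add hs]
    ring
  rw [setLIntegral_congr_fun measurableSet_Ioi hleft,
    setLIntegral_congr_fun measurableSet_Ioi hright,
    lintegral_const_mul _ (by fun_prop), lintegral_const_mul _ (by fun_prop),
    lintegral_rpow_mul_exp_neg_mul_Ioi (by linarith) hx, ← ENNReal.ofReal_mul hG1.le] at hswap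
  have hG0 : ENNReal.ofReal (Gamma (θ + 1)) ≠ 0 := by simpa using hG
  rw [← ENNReal.mul_right_inj hG0 ENNReal.ofReal_ne_top, hswap, ← ENNReal.ofReal_mul hG.le]
  congr 1
  rw [one_div, inv_rpow hx.le, ← rpow_neg hx.le, show -(α + θ) = -θ - α by ring]
  field_simp

theorem integrableOn_add_rpow_mul_rpow_Ioi {θ α x : ℝ} (hθ : 0 < θ) (hα : α ∈ Ioo (-θ) 1)
    (hx : 0 < x) :
    IntegrableOn (fun t : ℝ => (x + t) ^ (-θ - 1) * t ^ (-α)) (Ioi 0) := by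
  rw [IntegrableOn, ← lintegral_ofReal_ne_top_iff_integrable
    (Measurable.aestronglyMeasurable (by fun_prop)),
    lintegral_add_rpow_mul_rpow_Ioi hθ hα hx]
  · exact ENNReal.ofReal_ne_top
  · filter_upwards [ae_restrict_mem measurableSet_Ioi] with t ht
    have : 0 < t := ht
    simp only [Pi.zero_apply]
    positivity

theorem integral_add_rpow_mul_rpow_Ioi {θ α x : ℝ} (hθ : 0 < θ) (hα : α ∈ Ioo (-θ) 1)
    (hx : 0 < x) :
    ∫ t in Ioi (0 : ℝ), (x + t) ^ (-θ - 1) * t ^ (-α) =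
      x ^ (-θ - α) * (Gamma (1 - α) * Gamma (α + θ) / Gamma (θ + 1)) := by
  have hG : 0 < Gamma (θ + 1) := Gamma_pos_of_pos (by linarith)
  have hG1 : 0 < Gamma (1 - α) := Gamma_pos_of_pos (by linarith [hα.2])
  have hG2 : 0 < Gamma (α + θ) := Gamma_pos_of_pos (by linarith [hα.1])
  rw [integral_eq_lintegral_of_nonneg_ae _ (Measurable.aestronglyMeasurable (by fun_prop)),
    lintegral_add_rpow_mul_rpow_Ioi hθ hα hx, ENNReal.toReal_ofReal (by positivity)]
  filter_upwards [ae_restrict_mem measurableSet_Ioi] with t ht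
  have : 0 < t := ht
  simp only [Pi.zero_apply]
  positivity

theorem integrableOn_Ioi_one_comp_sub_one {f : ℝ → ℝ} (hf : IntegrableOn f (Ioi 0)) :
    IntegrableOn (fun t => f (t - 1)) (Ioi 1) := by
  have h := ((measurePreserving_sub_right volume (1 : ℝ)).integrableOn_comp_preimage
    (MeasurableEquiv.subRight (1 : ℝ)).measurableEmbedding).2 hf
  simpa [Function.comp_def] using h

theorem integral_Ioi_one_comp_sub_one (f : ℝ → ℝ) :
    ∫ t in Ioi (1 : ℝ), f (t - 1) = ∫ t in Ioi (0 : ℝ), f t := by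
  have h := (measurePreserving_sub_right volume (1 : ℝ)).setIntegral_preimage_emb
    (MeasurableEquiv.subRight (1 : ℝ)).measurableEmbedding f (Ioi 0)
  simpa using h

/-- The weighted kernel is integrable on `(1, ∞)`. -/
theorem integrableOn_kernel {θ α r : ℝ} (hθ : 0 < θ) (hα : α ∈ Ioo (-θ) 1) (hr : 1 < r) :
    IntegrableOn (fun t : ℝ => (r + t - 1) ^ (-θ - 1) * t ^ (-α)) (Ioi 1) := by
  have h := (integrableOn_add_rpow_mul_rpow_Ioi hθ hα (sub_pos.2 hr)).mono_set
    (Ioi_subset_Ioi zero_le_one)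
  simpa only [sub_add_eq_add_sub] using h

theorem integral_kernel_le_of_nonneg {θ α r : ℝ} (hθ : 0 < θ) (hα0 : 0 ≤ α) (hα1 : α < 1)
    (hr : 1 < r) :
    ∫ t in Ioi (1 : ℝ), (r + t - 1) ^ (-θ - 1) * t ^ (-α) ≤
      r ^ (-θ - α) * (Gamma (1 - α) * Gamma (α + θ) / Gamma (θ + 1)) := by
  have hα : α ∈ Ioo (-θ) 1 := ⟨by linarith, hα1⟩
  have hr0 : 0 < r := by linarith
  rw [← integral_add_rpow_mul_rpow_Ioi hθ hα hr0, ← integral_Ioi_one_comp_sub_one]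
  refine setIntegral_mono_on (integrableOn_kernel hθ hα hr)
    (integrableOn_Ioi_one_comp_sub_one (integrableOn_add_rpow_mul_rpow_Ioi hθ hα hr0))
    measurableSet_Ioi fun t ht => ?_
  have ht : 1 < t := ht
  rw [← add_sub_assoc]
  exact mul_le_mul_of_nonneg_left
    (rpow_le_rpow_of_nonpos (by linarith) (by linarith) (by linarith))
    (rpow_nonneg (by linarith) _)

theorem integral_kernel_le_of_nonpos {θ α r : ℝ} (hθ : 0 < θ) (hα : α ∈ Ioo (-θ) 1)
    (hr : 1 < r) :
    ∫ t in Ioi (1 : ℝ), (r + t - 1) ^ (-θ - 1) * t ^ (-α) ≤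
      (r - 1) ^ (-θ - α) * (Gamma (1 - α) * Gamma (α + θ) / Gamma (θ + 1)) := by
  have hx : 0 < r - 1 := sub_pos.2 hr
  rw [← integral_add_rpow_mul_rpow_Ioi hθ hα hx]
  simp_rw [← sub_add_eq_add_sub]
  refine setIntegral_mono_set (integrableOn_add_rpow_mul_rpow_Ioi hθ hα hx) ?_
    (Ioi_subset_Ioi zero_le_one).eventuallyLE
  filter_upwards [ae_restrict_mem measurableSet_Ioi] with t ht
  have : 0 < t := ht
  simp only [Pi.zero_apply]
  positivity

/-- The mass of the kernel of `S` in the weighted sup norm is at most `c(α,θ)`. -/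
theorem rpow_mul_integral_kernel_le {θ α r : ℝ} (hθ : 0 < θ) (hα : α ∈ Ioo (-θ) 1)
    (hr : 1 < r) :
    r ^ α * (θ * (r - 1) ^ θ *
      ∫ t in Ioi (1 : ℝ), (r + t - 1) ^ (-θ - 1) * t ^ (-α)) ≤
      Gamma (1 - α) * Gamma (α + θ) / Gamma θ := by
  have hr0 : 0 < r := by linarith
  have hx : 0 < r - 1 := sub_pos.2 hr
  have hG : 0 < Gamma θ := Gamma_pos_of_pos hθ
  have hG1 : 0 < Gamma (1 - α) := Gamma_pos_of_pos (by linarith [hα.2])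
  have hG2 : 0 < Gamma (α + θ) := Gamma_pos_of_pos (by linarith [hα.1])
  set c := Gamma (1 - α) * Gamma (α + θ) / Gamma θ with hc
  have hc0 : 0 ≤ c := by positivity
  have hcθ : θ * (Gamma (1 - α) * Gamma (α + θ) / Gamma (θ + 1)) = c := by
    rw [hc, Gamma_add_one hθ.ne']
    field_simp
  rcases le_total 0 α with h | h
  · calc r ^ α * (θ * (r - 1) ^ θ *
          ∫ t in Ioi (1 : ℝ), (r + t - 1) ^ (-θ - 1) * t ^ (-α))
        ≤ r ^ α * (θ * (r - 1) ^ θ *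
          (r ^ (-θ - α) * (Gamma (1 - α) * Gamma (α + θ) / Gamma (θ + 1)))) := by
          gcongr
          exact integral_kernel_le_of_nonneg hθ h hα.2 hr
      _ = ((r - 1) ^ θ * r ^ (-θ)) * (r ^ α * r ^ (-α)) * c := by
          rw [← hcθ, sub_eq_add_neg (-θ), rpow_add hr0]
          ring
      _ ≤ (r ^ θ * r ^ (-θ)) * (r ^ α * r ^ (-α)) * c := by
          gcongr
          linarith
      _ = c := by
          rw [← rpow_add hr0, ← rpow_add hr0]
          simp
  · calc r ^ α * (θ * (r - 1) ^ θ *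
          ∫ t in Ioi (1 : ℝ), (r + t - 1) ^ (-θ - 1) * t ^ (-α))
        ≤ r ^ α * (θ * (r - 1) ^ θ *
          ((r - 1) ^ (-θ - α) * (Gamma (1 - α) * Gamma (α + θ) / Gamma (θ + 1)))) := by
          gcongr
          exact integral_kernel_le_of_nonpos hθ hα hr
      _ = r ^ α * (r - 1) ^ (-α) * ((r - 1) ^ θ * (r - 1) ^ (-θ)) * c := by
          rw [← hcθ, sub_eq_add_neg (-θ), rpow_add hx]
          ring
      _ ≤ (r - 1) ^ α * (r - 1) ^ (-α) * ((r - 1) ^ θ * (r - 1) ^ (-θ)) * c := by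
          gcongr ?_ * _ * _ * _
          exact rpow_le_rpow_of_nonpos hx (by linarith) h
      _ = c := by
          rw [← rpow_add hx, ← rpow_add hx]
          simp

theorem one_le_div_of_mem_Ile {p : ℝ × ℝ} (hp : p ∈ Ile) : 1 ≤ p.2 / p.1 :=
  (one_le_div hp.1).2 hp.2

theorem eq_or_one_lt_div_of_mem_Ile {p : ℝ × ℝ} (hp : p ∈ Ile) :
    p.2 / p.1 = 1 ∨ 1 < p.2 / p.1 :=
  (one_le_div_of_mem_Ile hp).eq_or_lt.imp Eq.symm id

theorem sub_pos_of_one_lt_div {p : ℝ × ℝ} (hp : p ∈ Ile) (h : 1 < p.2 / p.1) :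
    0 < p.2 - p.1 :=
  sub_pos.2 ((one_lt_div hp.1).1 h)

theorem div_mem_Ile {a t : ℝ} (ha : 0 < a) (ht : 1 < t) : (a / t, a) ∈ Ile :=
  ⟨div_pos ha (by linarith), div_le_self ha.le ht.le⟩

/-- A function dominated by `M (s₂/s₁)^{-α}` is mapped by the linear part of `S` to a function
of weighted sup norm at most `c(α,θ) M`. -/
theorem rpow_mul_abs_linear_part_le {θ α M : ℝ} {H : ℝ × ℝ → ℝ} (hθ : 0 < θ)
    (hα : α ∈ Ioo (-θ) 1) (hM : 0 ≤ M)
    (hH : ∀ p ∈ Ile, |H p| ≤ M * (p.2 / p.1) ^ (-α)) {p : ℝ × ℝ} (hp : p ∈ Ile) :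
    (p.2 / p.1) ^ α * |θ * (p.2 / p.1 - 1) ^ θ * ∫ t in Ioi (1 : ℝ),
      (p.2 / p.1 + t - 1) ^ (-θ - 1) * H ((p.2 - p.1) / t, p.2 - p.1)| ≤
      Gamma (1 - α) * Gamma (α + θ) / Gamma θ * M := by
  have hG : 0 < Gamma θ := Gamma_pos_of_pos hθ
  have hG1 : 0 < Gamma (1 - α) := Gamma_pos_of_pos (by linarith [hα.2])
  have hG2 : 0 < Gamma (α + θ) := Gamma_pos_of_pos (by linarith [hα.1])
  rcases eq_or_one_lt_div_of_mem_Ile hp with h | h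
  · rw [h, sub_self, zero_rpow hθ.ne', mul_zero, zero_mul, abs_zero, mul_zero]
    positivity
  have ha := sub_pos_of_one_lt_div hp h
  set r := p.2 / p.1 with hr
  have hI : |∫ t in Ioi (1 : ℝ), (r + t - 1) ^ (-θ - 1) * H ((p.2 - p.1) / t, p.2 - p.1)| ≤
      (∫ t in Ioi (1 : ℝ), (r + t - 1) ^ (-θ - 1) * t ^ (-α)) * M := by
    rw [← integral_mul_const, ← norm_eq_abs]
    refine norm_integral_le_of_norm_le ((integrableOn_kernel hθ hα h).mul_const M) ?_
    filter_upwards [ae_restrict_mem measurableSet_Ioi] with t ht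
    have ht : 1 < t := ht
    have hk : 0 ≤ (r + t - 1) ^ (-θ - 1) := rpow_nonneg (by linarith) _
    have hb := hH _ (div_mem_Ile ha ht)
    simp only [div_div_cancel₀ ha.ne'] at hb
    rw [norm_eq_abs, abs_mul, abs_of_nonneg hk, mul_assoc, mul_comm _ M]
    exact mul_le_mul_of_nonneg_left hb hk
  have hx : 0 ≤ r - 1 := by linarith
  have hpos : 0 ≤ θ * (r - 1) ^ θ := by positivity
  rw [abs_mul, abs_of_nonneg hpos]
  calc _ ≤ r ^ α * (θ * (r - 1) ^ θ *
        ((∫ t in Ioi (1 : ℝ), (r + t - 1) ^ (-θ - 1) * t ^ (-α)) * M)) := by gcongr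
    _ = r ^ α * (θ * (r - 1) ^ θ *
        ∫ t in Ioi (1 : ℝ), (r + t - 1) ^ (-θ - 1) * t ^ (-α)) * M := by ring
    _ ≤ _ := mul_le_mul_of_nonneg_right (rpow_mul_integral_kernel_le hθ hα h) hM

theorem integrableOn_kernel_mul {θ : ℝ} {F : ℝ × ℝ → ℝ} (hθ : 0 < θ) (hF : Measurable F)
    (hF1 : ∀ p ∈ Ile, F p ∈ Icc (0 : ℝ) 1) {r a : ℝ} (hr : 1 < r) (ha : 0 < a) :
    IntegrableOn (fun t : ℝ => (r + t - 1) ^ (-θ - 1) * F (a / t, a)) (Ioi 1) := by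
  have h := integrableOn_kernel hθ (α := 0) ⟨by linarith, one_pos⟩ hr
  refine Integrable.mono' h (Measurable.aestronglyMeasurable (by fun_prop)) ?_
  filter_upwards [ae_restrict_mem measurableSet_Ioi] with t ht
  have ht : 1 < t := ht
  have hk : 0 ≤ (r + t - 1) ^ (-θ - 1) := rpow_nonneg (by linarith) _
  have hb := hF1 _ (div_mem_Ile ha ht)
  rw [norm_eq_abs, abs_of_nonneg (mul_nonneg hk hb.1), neg_zero, rpow_zero]
  exact mul_le_mul_of_nonneg_left hb.2 hk

theorem linear_part_mem_Icc {θ : ℝ} {F : ℝ × ℝ → ℝ} (hθ : 0 < θ) (hF : Measurable F)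
    (hF1 : ∀ p ∈ Ile, F p ∈ Icc (0 : ℝ) 1) {p : ℝ × ℝ} (hp : p ∈ Ile) :
    θ * (p.2 / p.1 - 1) ^ θ * ∫ t in Ioi (1 : ℝ),
      (p.2 / p.1 + t - 1) ^ (-θ - 1) * F ((p.2 - p.1) / t, p.2 - p.1) ∈
      Icc 0 ((1 - p.1 / p.2) ^ θ) := by
  rcases eq_or_one_lt_div_of_mem_Ile hp with h | h
  · have h' : p.1 / p.2 = 1 := by rw [← inv_div, h, inv_one]
    simp [h, h', zero_rpow hθ.ne']
  have ha := sub_pos_of_one_lt_div hp h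
  have hinv : p.1 / p.2 = (p.2 / p.1)⁻¹ := (inv_div _ _).symm
  rw [hinv]
  set r := p.2 / p.1 with hr
  have hr0 : 0 < r := by linarith
  have hx : 0 ≤ r - 1 := by linarith
  have hI0 : 0 ≤ ∫ t in Ioi (1 : ℝ),
      (r + t - 1) ^ (-θ - 1) * F ((p.2 - p.1) / t, p.2 - p.1) := by
    refine setIntegral_nonneg measurableSet_Ioi fun t ht => ?_
    have ht : 1 < t := ht
    exact mul_nonneg (rpow_nonneg (by linarith) _) (hF1 _ (div_mem_Ile ha ht)).1
  refine ⟨by positivity, ?_⟩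
  have hI1 : ∫ t in Ioi (1 : ℝ), (r + t - 1) ^ (-θ - 1) * F ((p.2 - p.1) / t, p.2 - p.1) ≤
      r ^ (-θ) / θ := by
    have hk := integral_kernel_le_of_nonneg hθ le_rfl one_pos h
    rw [sub_zero, sub_zero, zero_add, Gamma_one, one_mul, Gamma_add_one hθ.ne',
      div_mul_cancel_right₀ (Gamma_pos_of_pos hθ).ne', ← div_eq_mul_inv] at hk
    refine (setIntegral_mono_on (integrableOn_kernel_mul hθ hF hF1 h ha)
      (integrableOn_kernel hθ (α := 0) ⟨by linarith, one_pos⟩ h) measurableSet_Ioi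
      fun t ht => ?_).trans hk
    have ht : 1 < t := ht
    rw [neg_zero, rpow_zero]
    exact mul_le_mul_of_nonneg_left (hF1 _ (div_mem_Ile ha ht)).2
      (rpow_nonneg (by linarith) _)
  calc _ ≤ θ * (r - 1) ^ θ * (r ^ (-θ) / θ) := by gcongr
    _ = ((r - 1) * r⁻¹) ^ θ := by
      rw [mul_rpow hx (by positivity), inv_rpow hr0.le, rpow_neg hr0.le]
      field_simp
    _ = (1 - r⁻¹) ^ θ := by
      rw [sub_mul, mul_inv_cancel₀ hr0.ne', one_mul]

theorem one_sub_one_sub_rpow_le {θ y : ℝ} (hy0 : 0 ≤ y) (hy1 : y ≤ 1) :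
    1 - (1 - y) ^ θ ≤ max θ 1 * y := by
  rcases le_total 1 θ with h | h
  · have hb := one_add_mul_self_le_rpow_one_add (s := -y) (by linarith) h
    rw [← sub_eq_add_neg] at hb
    rw [max_eq_left h]
    linarith
  · rw [max_eq_right h]
    rcases hy1.eq_or_lt with rfl | hy
    · have := rpow_nonneg (sub_nonneg.2 hy1) θ
      linarith
    · have := rpow_le_rpow_of_exponent_ge (sub_pos.2 hy) (by linarith) h
      rw [rpow_one] at this
      linarith

theorem rpow_mul_one_sub_le {θ α r : ℝ} (hα : α < 1) (hr : 1 ≤ r) :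
    r ^ α * (1 - (1 - r⁻¹) ^ θ) ≤ max θ 1 := by
  have hr0 : 0 < r := by linarith
  have hm : (0 : ℝ) ≤ max θ 1 := zero_le_one.trans (le_max_right _ _)
  calc r ^ α * (1 - (1 - r⁻¹) ^ θ) ≤ r ^ α * (max θ 1 * r⁻¹) := by
        gcongr
        exact one_sub_one_sub_rpow_le (by positivity) (inv_le_one_of_one_le₀ hr)
    _ = max θ 1 * r ^ (α - 1) := by
        rw [rpow_sub_one hr0.ne']
        ring
    _ ≤ max θ 1 * 1 := by
        gcongr
        exact rpow_le_one_of_one_le_of_nonpos hr (by linarith)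
    _ = max θ 1 := mul_one _

theorem measurable_S {θ : ℝ} {F : ℝ × ℝ → ℝ} (hF : Measurable F) : Measurable (S θ F) := by
  have h : Measurable fun q : (ℝ × ℝ) × ℝ =>
      (q.1.2 / q.1.1 + q.2 - 1) ^ (-θ - 1) * F ((q.1.2 - q.1.1) / q.2, q.1.2 - q.1.1) := by
    fun_prop
  have hI := (h.stronglyMeasurable.integral_prod_right'
    (ν := volume.restrict (Ioi (1 : ℝ)))).measurable
  unfold S
  exact Measurable.add (by fun_prop) (Measurable.mul (by fun_prop) hI)

theorem abs_le_normG_mul {α : ℝ} {F : ℝ × ℝ → ℝ}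
    (hF : BddAbove ((fun p : ℝ × ℝ => (p.2 / p.1) ^ α * |F p|) '' Ile))
    {p : ℝ × ℝ} (hp : p ∈ Ile) : |F p| ≤ normG α F * (p.2 / p.1) ^ (-α) := by
  have hr : 0 < p.2 / p.1 := zero_lt_one.trans_le (one_le_div_of_mem_Ile hp)
  have h := le_csSup hF (mem_image_of_mem _ hp)
  rw [rpow_neg hr.le, ← div_eq_mul_inv, le_div_iff₀ (by positivity), mul_comm]
  exact h

theorem normG_nonneg (α : ℝ) (F : ℝ × ℝ → ℝ) : 0 ≤ normG α F := by
  refine Real.sSup_nonneg ?_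
  rintro _ ⟨p, hp, rfl⟩
  have hr : 0 < p.2 / p.1 := zero_lt_one.trans_le (one_le_div_of_mem_Ile hp)
  positivity

theorem MemG.bddAbove_sub {α : ℝ} {F₁ F₂ : ℝ × ℝ → ℝ} (h₁ : MemG α F₁) (h₂ : MemG α F₂) :
    BddAbove ((fun p : ℝ × ℝ => (p.2 / p.1) ^ α * |F₁ p - F₂ p|) '' Ile) := by
  obtain ⟨B₁, hB₁⟩ := h₁.2.2
  obtain ⟨B₂, hB₂⟩ := h₂.2.2
  refine ⟨B₁ + B₂, ?_⟩
  rintro _ ⟨p, hp, rfl⟩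
  have hr : 0 < p.2 / p.1 := zero_lt_one.trans_le (one_le_div_of_mem_Ile hp)
  calc (p.2 / p.1) ^ α * |F₁ p - F₂ p| ≤ (p.2 / p.1) ^ α * (|F₁ p| + |F₂ p|) := by
        gcongr
        exact abs_sub _ _
    _ = (p.2 / p.1) ^ α * |F₁ p| + (p.2 / p.1) ^ α * |F₂ p| := mul_add _ _ _
    _ ≤ B₁ + B₂ := add_le_add (hB₁ (mem_image_of_mem _ hp)) (hB₂ (mem_image_of_mem _ hp))

theorem MemG.map_S {θ α : ℝ} {F : ℝ × ℝ → ℝ} (hθ : 0 < θ) (hα : α ∈ Ioo (-θ) 1)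
    (hF : MemG α F) : MemG α (S θ F) := by
  have hmem : ∀ p ∈ Ile, S θ F p ∈ Icc (0 : ℝ) 1 := by
    intro p hp
    have h := linear_part_mem_Icc hθ hF.1 hF.2.1 hp
    have hy0 : 0 ≤ p.1 / p.2 := div_nonneg hp.1.le (hp.1.le.trans hp.2)
    have hy1 : p.1 / p.2 ≤ 1 := div_le_one_of_le₀ hp.2 (hp.1.le.trans hp.2)
    have hle := rpow_le_one (sub_nonneg.2 hy1) (by linarith) hθ.le
    exact ⟨add_nonneg (sub_nonneg.2 hle) h.1, by unfold S; linarith [h.2]⟩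
  refine ⟨measurable_S hF.1, hmem,
    max θ 1 + Gamma (1 - α) * Gamma (α + θ) / Gamma θ * normG α F, ?_⟩
  rintro _ ⟨p, hp, rfl⟩
  have hr := one_le_div_of_mem_Ile hp
  have hL := (rpow_mul_abs_linear_part_le hθ hα (normG_nonneg α F)
    (fun q hq => abs_le_normG_mul hF.2.2 hq) hp)
  have hB := rpow_mul_one_sub_le (θ := θ) hα.2 hr
  simp only [abs_of_nonneg (hmem p hp).1]
  unfold S
  rw [inv_div] at hB
  rw [mul_add]
  refine add_le_add hB (le_trans ?_ hL)
  gcongr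
  exact le_abs_self _

theorem S_sub_S {θ : ℝ} {F₁ F₂ : ℝ × ℝ → ℝ} (hθ : 0 < θ) (h₁ : Measurable F₁)
    (h₂ : Measurable F₂) (h₁' : ∀ p ∈ Ile, F₁ p ∈ Icc (0 : ℝ) 1)
    (h₂' : ∀ p ∈ Ile, F₂ p ∈ Icc (0 : ℝ) 1) {p : ℝ × ℝ} (hp : p ∈ Ile) :
    S θ F₁ p - S θ F₂ p = θ * (p.2 / p.1 - 1) ^ θ * ∫ t in Ioi (1 : ℝ),
      (p.2 / p.1 + t - 1) ^ (-θ - 1) *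
        (F₁ ((p.2 - p.1) / t, p.2 - p.1) - F₂ ((p.2 - p.1) / t, p.2 - p.1)) := by
  unfold S
  rw [add_sub_add_left_eq_sub]
  rcases eq_or_one_lt_div_of_mem_Ile hp with h | h
  · simp [h, zero_rpow hθ.ne']
  have ha := sub_pos_of_one_lt_div hp h
  rw [← mul_sub, ← integral_sub (integrableOn_kernel_mul hθ h₁ h₁' h ha)
    (integrableOn_kernel_mul hθ h₂ h₂' h ha)]
  simp_rw [mul_sub]

/-- For `θ > 0` and `α ∈ (−θ, 1)`, the space `G_α` is stable
under `S`, and `S : G_α → G_α` is Lipschitz with constant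
`c(α,θ) = Γ(1−α)Γ(α+θ)/Γ(θ)` for the norm `‖·‖_{G_α}`. -/
theorem S_stable_and_lipschitz (θ α : ℝ) (hθ : 0 < θ) (hα : α ∈ Ioo (-θ) 1) :
    (∀ F : ℝ × ℝ → ℝ, MemG α F → MemG α (S θ F)) ∧
      ∀ F₁ F₂ : ℝ × ℝ → ℝ, MemG α F₁ → MemG α F₂ →
        normG α (fun p => S θ F₁ p - S θ F₂ p) ≤
          Real.Gamma (1 - α) * Real.Gamma (α + θ) / Real.Gamma θ *
            normG α (fun p => F₁ p - F₂ p) := by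
  refine ⟨fun F hF => hF.map_S hθ hα, fun F₁ F₂ h₁ h₂ => ?_⟩
  refine csSup_le (Nonempty.image _ ⟨(1, 1), one_pos, le_rfl⟩) ?_
  rintro _ ⟨p, hp, rfl⟩
  simp only [S_sub_S hθ h₁.1 h₂.1 h₁.2.1 h₂.2.1 hp]
  exact rpow_mul_abs_linear_part_le hθ hα (normG_nonneg α _)
    (fun q hq => abs_le_normG_mul (h₁.bddAbove_sub h₂) hq) hp
end

section
/- Let θ ∈ (0,1) and α ∈ (0, 1−θ). The function F(s₁,s₂) := f_Bes(s₂/s₁), where f_Bes(s) = (sin(πθ)/π) ∫_{s−1}^∞ t^{θ−1}(t+1)^{−1} dt, belongs to G_α and satisfies S(F) = F; moreover any G ∈ G_α with S(G) = G agrees with F almost everywhere. In particular the unique fixed point of S in G_α is a function of the ratio s₂/s₁ alone. -/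
open MeasureTheory Real Set

/-- The Bessel function `f_Bes(s) = (sin(πθ)/π) ∫_{s−1}^∞ t^{θ−1}(t+1)^{−1} dt`. -/
noncomputable def fBes (θ : ℝ) : ℝ → ℝ :=
  fun s => Real.sin (π * θ) / π * ∫ t in Ioi (s - 1), t ^ (θ - 1) * (t + 1)⁻¹

open Filter Topology ProbabilityTheory

theorem integral_Ioo_rpow_mul_one_sub_rpow {a b : ℝ} (ha : 0 < a) (hb : 0 < b) :
    ∫ x in Ioo (0 : ℝ) 1, x ^ (a - 1) * (1 - x) ^ (b - 1) = beta a b := by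
  rw [beta_eq_betaIntegralReal a b ha hb, Complex.betaIntegral,
    intervalIntegral.integral_of_le (by norm_num), ← integral_Ioc_eq_integral_Ioo,
    ← RCLike.re_to_complex, ← integral_re]
  · refine setIntegral_congr_fun measurableSet_Ioc fun x ⟨hx1, hx2⟩ ↦ ?_
    norm_cast
    rw [← Complex.ofReal_cpow, ← Complex.ofReal_cpow, RCLike.re_to_complex,
      Complex.re_mul_ofReal, Complex.ofReal_re]
    all_goals linarith
  · have := Complex.betaIntegral_convergent (u := a) (v := b) (by simpa) (by simpa)
    rwa [intervalIntegrable_iff_integrableOn_Ioc_of_le (by simp), IntegrableOn] at this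

theorem image_div_add_one_Ioi_zero : (fun t : ℝ => t / (t + 1)) '' Ioi 0 = Ioo 0 1 := by
  ext x
  simp only [mem_image, mem_Ioi, mem_Ioo]
  constructor
  · rintro ⟨t, ht, rfl⟩
    exact ⟨by positivity, by rw [div_lt_one (by positivity)]; linarith⟩
  · rintro ⟨h0, h1⟩
    have : 1 - x ≠ 0 := by linarith
    refine ⟨x / (1 - x), div_pos h0 (by linarith), ?_⟩
    field_simp
    ring

/-- The beta integral of the second kind. -/
theorem integral_Ioi_rpow_mul_add_one_rpow {a b : ℝ} (ha : 0 < a) (hb : 0 < b) :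
    ∫ t in Ioi (0 : ℝ), t ^ (a - 1) * (t + 1) ^ (-(a + b)) = beta a b := by
  have hderiv : ∀ t ∈ Ioi (0 : ℝ),
      HasDerivWithinAt (fun t : ℝ => t / (t + 1)) (1 / (t + 1) ^ 2) (Ioi 0) t := by
    intro t (ht : 0 < t)
    have := ((hasDerivAt_id t).div ((hasDerivAt_id t).add_const 1)
      (by simp; positivity)).hasDerivWithinAt (s := Ioi 0)
    convert! this using 1
    simp
  have hinj : InjOn (fun t : ℝ => t / (t + 1)) (Ioi 0) := by
    intro x (hx : 0 < x) y (hy : 0 < y) h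
    simp only at h
    field_simp at h
    linarith
  rw [← integral_Ioo_rpow_mul_one_sub_rpow ha hb, ← image_div_add_one_Ioi_zero,
    integral_image_eq_integral_abs_deriv_smul measurableSet_Ioi hderiv hinj]
  refine setIntegral_congr_fun measurableSet_Ioi fun t (ht : 0 < t) ↦ ?_
  have h1 : 0 < t + 1 := by positivity
  have h2 : 1 - t / (t + 1) = (t + 1)⁻¹ := by field_simp; ring
  simp only [smul_eq_mul]
  rw [h2, div_rpow ht.le h1.le, inv_rpow h1.le, ← rpow_neg h1.le, abs_of_pos (by positivity),
    div_eq_mul_inv (t ^ (a - 1)), ← rpow_neg h1.le,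
    show (1 / (t + 1) ^ 2 : ℝ) = (t + 1) ^ (-2 : ℝ) by
      rw [rpow_neg h1.le, one_div]; norm_cast,
    show -(a + b) = -2 + (-(a - 1) + -(b - 1)) by ring, rpow_add h1, rpow_add h1]
  ring

theorem integrableOn_Ioi_rpow_mul_add_one_rpow {a b : ℝ} (ha : 0 < a) (hb : 0 < b) :
    IntegrableOn (fun t : ℝ => t ^ (a - 1) * (t + 1) ^ (-(a + b))) (Ioi 0) := by
  apply Integrable.of_integral_ne_zero
  rw [integral_Ioi_rpow_mul_add_one_rpow ha hb]
  exact (beta_pos ha hb).ne'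

theorem mul_beta_one_right {a : ℝ} (ha : 0 < a) : a * beta a 1 = 1 := by
  have := Gamma_pos_of_pos ha
  rw [beta, Gamma_add_one ha.ne', Gamma_one]
  field_simp

theorem mul_beta_one_left {a : ℝ} (ha : 0 < a) : a * beta 1 a = 1 := by
  have := Gamma_pos_of_pos ha
  rw [beta, add_comm, Gamma_add_one ha.ne', Gamma_one]
  field_simp

/-- Strict log-convexity of the Gamma function between `θ` and `1`, in beta function form. -/
theorem mul_beta_lt_one {θ α : ℝ} (hθ : θ ∈ Ioo (0 : ℝ) 1) (hα : α ∈ Ioo (0 : ℝ) (1 - θ)) :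
    θ * beta (1 - α) (θ + α) < 1 := by
  obtain ⟨h0, h1⟩ := hθ
  obtain ⟨hα0, hα1⟩ := hα
  have hθ1 : 0 < 1 - θ := by linarith
  set w := α / (1 - θ) with hw
  have hw0 : 0 < w := div_pos hα0 hθ1
  have hw1 : 0 < 1 - w := by rw [sub_pos, div_lt_one hθ1]; exact hα1
  have hwm : (θ - 1) * w = -α := by rw [hw]; field_simp; ring
  have hI : IntegrableOn (fun t : ℝ => t ^ (1 - α - 1) * (t + 1) ^ (-(1 - α + (θ + α)))) (Ioi 0) :=
    integrableOn_Ioi_rpow_mul_add_one_rpow (by linarith) (by linarith)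
  have hI1 := integrableOn_Ioi_rpow_mul_add_one_rpow one_pos h0
  have hI2 := integrableOn_Ioi_rpow_mul_add_one_rpow h0 one_pos
  have hJ : IntegrableOn (fun t : ℝ => (1 - w) * (t ^ ((1 : ℝ) - 1) * (t + 1) ^ (-(1 + θ))) +
      w * (t ^ (θ - 1) * (t + 1) ^ (-(θ + 1)))) (Ioi 0) :=
    (hI1.const_mul (1 - w)).add (hI2.const_mul w)
  have hlt : ∀ t ∈ Ioi (0 : ℝ), t ≠ 1 → 0 <
      ((1 - w) * (t ^ ((1 : ℝ) - 1) * (t + 1) ^ (-(1 + θ))) +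
        w * (t ^ (θ - 1) * (t + 1) ^ (-(θ + 1)))) -
      t ^ (1 - α - 1) * (t + 1) ^ (-(1 - α + (θ + α))) := by
    intro t (ht : 0 < t) ht1
    have hne : (1 : ℝ) ≠ t ^ (θ - 1) := by
      intro h
      have hlog := congrArg Real.log h
      rw [log_one, log_rpow ht, eq_comm, mul_eq_zero] at hlog
      rcases hlog with hlog | hlog
      · linarith
      · exact ht1 (eq_one_of_pos_of_log_eq_zero ht hlog)
    have := (geom_mean_lt_arith_mean2_weighted_iff_of_pos hw1 hw0 zero_le_one
      (rpow_nonneg ht.le (θ - 1)) (by ring)).2 hne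
    rw [one_rpow, one_mul, mul_one, ← rpow_mul ht.le, hwm] at this
    have hp : 0 < (t + 1) ^ (-(1 + θ)) := rpow_pos_of_pos (by positivity) _
    rw [show -(1 - α + (θ + α)) = -(1 + θ) by ring, show 1 - α - 1 = -α by ring, add_comm θ 1,
      sub_self, rpow_zero]
    nlinarith
  have hle : ∀ t ∈ Ioi (0 : ℝ), 0 ≤
      ((1 - w) * (t ^ ((1 : ℝ) - 1) * (t + 1) ^ (-(1 + θ))) +
        w * (t ^ (θ - 1) * (t + 1) ^ (-(θ + 1)))) -
      t ^ (1 - α - 1) * (t + 1) ^ (-(1 - α + (θ + α))) := by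
    intro t ht
    rcases eq_or_ne t 1 with rfl | ht1
    · rw [show -(1 - α + (θ + α)) = -(1 + θ) by ring, add_comm θ 1]
      simp only [one_rpow]
      apply le_of_eq
      ring
    · exact (hlt t ht ht1).le
  have hpos := (setIntegral_pos_iff_support_of_nonneg_ae
    (ae_restrict_of_forall_mem measurableSet_Ioi hle) (hJ.sub hI)).2 (by
      refine lt_of_lt_of_le (b := volume (Ioo (0 : ℝ) 1)) (by simp) (measure_mono fun t ht => ?_)
      exact ⟨(hlt t ht.1 ht.2.ne).ne', ht.1⟩)
  rw [integral_sub hJ hI, integral_add (hI1.const_mul _) (hI2.const_mul _),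
    integral_const_mul, integral_const_mul, integral_Ioi_rpow_mul_add_one_rpow one_pos h0,
    integral_Ioi_rpow_mul_add_one_rpow h0 one_pos,
    integral_Ioi_rpow_mul_add_one_rpow (by linarith) (by linarith)] at hpos
  have := mul_pos h0 hpos
  nlinarith [mul_beta_one_left h0, mul_beta_one_right h0]

theorem fBes_one {θ : ℝ} (hθ : θ ∈ Ioo (0 : ℝ) 1) : fBes θ 1 = 1 := by
  have h := integral_Ioi_rpow_mul_add_one_rpow hθ.1 (sub_pos.2 hθ.2)
  simp only [add_sub_cancel, rpow_neg_one] at h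
  have hs : 0 < Real.sin (π * θ) :=
    sin_pos_of_pos_of_lt_pi (mul_pos pi_pos hθ.1) (by nlinarith [pi_pos, hθ.2])
  rw [fBes, sub_self, h, beta, add_sub_cancel, Gamma_one, Gamma_mul_Gamma_one_sub]
  field_simp

theorem integrableOn_fBes_integrand {θ : ℝ} (hθ : θ ∈ Ioo (0 : ℝ) 1) :
    IntegrableOn (fun t : ℝ => t ^ (θ - 1) * (t + 1)⁻¹) (Ioi 0) := by
  have h := integrableOn_Ioi_rpow_mul_add_one_rpow hθ.1 (sub_pos.2 hθ.2)
  simpa only [add_sub_cancel, rpow_neg_one] using h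

theorem sin_pi_mul_div_pi_pos {θ : ℝ} (hθ : θ ∈ Ioo (0 : ℝ) 1) : 0 < Real.sin (π * θ) / π :=
  div_pos (sin_pos_of_pos_of_lt_pi (mul_pos pi_pos hθ.1) (by nlinarith [pi_pos, hθ.2])) pi_pos

theorem fBes_mem_Icc {θ s : ℝ} (hθ : θ ∈ Ioo (0 : ℝ) 1) (hs : 1 ≤ s) :
    fBes θ s ∈ Icc (0 : ℝ) 1 := by
  have hc := sin_pi_mul_div_pi_pos hθ
  have hnn : ∀ t ∈ Ioi (0 : ℝ), 0 ≤ t ^ (θ - 1) * (t + 1)⁻¹ := fun t (ht : 0 < t) => by positivity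
  constructor
  · exact mul_nonneg hc.le (setIntegral_nonneg measurableSet_Ioi fun t (ht : s - 1 < t) =>
      hnn t (show 0 < t by linarith))
  · rw [← fBes_one hθ]
    refine mul_le_mul_of_nonneg_left ?_ hc.le
    rw [sub_self]
    exact setIntegral_mono_set (integrableOn_fBes_integrand hθ)
      (ae_restrict_of_forall_mem measurableSet_Ioi hnn)
      (Ioi_subset_Ioi (by linarith)).eventuallyLE

/-- `fBes θ` decays at least as fast as `s ^ (-α)` for every `α ∈ (0, 1 - θ)`. -/
theorem rpow_mul_fBes_le {θ α s : ℝ} (hθ : θ ∈ Ioo (0 : ℝ) 1) (hα : α ∈ Ioo (0 : ℝ) (1 - θ))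
    (hs : 1 ≤ s) : s ^ α * fBes θ s ≤ Real.sin (π * θ) / π * beta θ (1 - θ - α) := by
  have hc := sin_pi_mul_div_pi_pos hθ
  have hI := integrableOn_Ioi_rpow_mul_add_one_rpow hθ.1 (sub_pos.2 hα.2)
  rw [fBes, mul_left_comm, ← integral_const_mul]
  refine mul_le_mul_of_nonneg_left ?_ hc.le
  rw [← integral_Ioi_rpow_mul_add_one_rpow hθ.1 (sub_pos.2 hα.2)]
  refine le_trans (setIntegral_mono_on (((integrableOn_fBes_integrand hθ).mono_set
    (Ioi_subset_Ioi (by linarith))).const_mul _) (hI.mono_set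
    (Ioi_subset_Ioi (by linarith))) measurableSet_Ioi fun t (ht : s - 1 < t) => ?_)
    (setIntegral_mono_set hI (ae_restrict_of_forall_mem measurableSet_Ioi
      fun t (ht : 0 < t) => ?_) (Ioi_subset_Ioi (by linarith)).eventuallyLE)
  · have h0 : 0 < t := by linarith
    have h1 : 0 < t + 1 := by linarith
    rw [mul_left_comm]
    refine mul_le_mul_of_nonneg_left ?_ (rpow_nonneg h0.le _)
    rw [show -(θ + (1 - θ - α)) = α + -1 by ring, rpow_add h1, rpow_neg_one]
    refine mul_le_mul_of_nonneg_right ?_ (by positivity)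
    exact rpow_le_rpow (by linarith) (by linarith) hα.1.le
  · simp only [Pi.zero_apply]
    positivity

theorem measurable_fBes (θ : ℝ) : Measurable (fBes θ) := by
  unfold fBes
  refine Measurable.const_mul ?_ _
  simp_rw [← integral_indicator measurableSet_Ioi]
  have : Measurable (fun q : ℝ × ℝ =>
      {q : ℝ × ℝ | q.1 - 1 < q.2}.indicator (fun q => q.2 ^ (θ - 1) * (q.2 + 1)⁻¹) q) :=
    Measurable.indicator (by fun_prop) (measurableSet_lt (by fun_prop) (by fun_prop))
  exact (this.stronglyMeasurable.integral_prod_right' (ν := volume)).measurable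

theorem memG_fBes_ratio {θ α : ℝ} (hθ : θ ∈ Ioo (0 : ℝ) 1) (hα : α ∈ Ioo (0 : ℝ) (1 - θ)) :
    MemG α (fun p : ℝ × ℝ => fBes θ (p.2 / p.1)) := by
  have hr : ∀ p ∈ Ile, 1 ≤ p.2 / p.1 := fun p hp => (one_le_div hp.1).2 hp.2
  refine ⟨(measurable_fBes θ).comp (by fun_prop), fun p hp => fBes_mem_Icc hθ (hr p hp),
    Real.sin (π * θ) / π * beta θ (1 - θ - α), ?_⟩
  rintro _ ⟨p, hp, rfl⟩
  change (p.2 / p.1) ^ α * |fBes θ (p.2 / p.1)| ≤ _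
  rw [abs_of_nonneg (fBes_mem_Icc hθ (hr p hp)).1]
  exact rpow_mul_fBes_le hθ hα (hr p hp)

theorem continuousOn_fBes {θ : ℝ} (hθ : θ ∈ Ioo (0 : ℝ) 1) :
    ContinuousOn (fBes θ) (Ici 1) := by
  refine continuousOn_const.mul
    ((integrableOn_fBes_integrand hθ).continuousOn_Ici_primitive_Ioi.comp
    (f := fun s : ℝ => s - 1) (by fun_prop) fun s (hs : 1 ≤ s) => ?_)
  exact sub_nonneg.2 hs

theorem hasDerivAt_fBes {θ s : ℝ} (hθ : θ ∈ Ioo (0 : ℝ) 1) (hs : 1 < s) :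
    HasDerivAt (fBes θ) (-(Real.sin (π * θ) / π * ((s - 1) ^ (θ - 1) * s⁻¹))) s := by
  have hg := integrableOn_fBes_integrand hθ
  have hs0 : 0 < s - 1 := sub_pos.2 hs
  have h1 : HasDerivAt (fun u => ∫ t in (0 : ℝ)..u, t ^ (θ - 1) * (t + 1)⁻¹)
      ((s - 1) ^ (θ - 1) * (s - 1 + 1)⁻¹) (s - 1) := by
    refine intervalIntegral.integral_hasDerivAt_right
      ((intervalIntegrable_iff_integrableOn_Ioc_of_le hs0.le).2
        (hg.mono_set Ioc_subset_Ioi_self)) ?_ ?_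
    · exact (Measurable.aestronglyMeasurable (by fun_prop)).stronglyMeasurableAtFilter
    · exact (continuousAt_rpow_const _ _ (Or.inl hs0.ne')).mul
        (ContinuousAt.inv₀ (by fun_prop) (by linarith))
  have h2 := ((h1.comp_sub_const s 1).const_sub
    (∫ t in Ioi (0 : ℝ), t ^ (θ - 1) * (t + 1)⁻¹)).const_mul (Real.sin (π * θ) / π)
  rw [sub_add_cancel, mul_neg] at h2
  refine h2.congr_of_eventuallyEq ?_
  filter_upwards [Ioi_mem_nhds hs] with u (hu : 1 < u)
  rw [fBes, ← intervalIntegral.integral_Ioi_sub_Ioi hg (sub_nonneg.2 hu.le), sub_sub_cancel]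

/-- The fixed point equation for `fBes θ` in the ratio variable. -/
theorem integral_rpow_mul_fBes {θ r : ℝ} (hθ : θ ∈ Ioo (0 : ℝ) 1) (hr : 1 < r) :
    θ * (r - 1) ^ θ * ∫ t in Ioi (1 : ℝ), (r + t - 1) ^ (-θ - 1) * fBes θ t =
      fBes θ r - (1 - (r - 1) ^ θ * r ^ (-θ)) := by
  have hr0 : 0 < r := by linarith
  have hr1 : 0 < r - 1 := by linarith
  have hσ1 : ∀ t : ℝ, 1 ≤ t →
      r - r * (r - 1) * (r + t - 1)⁻¹ = 1 + (r - 1) * (t - 1) * (r + t - 1)⁻¹ := by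
    intro t ht
    have : r + t - 1 ≠ 0 := by linarith
    field_simp
    ring
  set W : ℝ → ℝ := fun t => fBes θ (r - r * (r - 1) * (r + t - 1)⁻¹) -
    (r - 1) ^ θ * (r + t - 1) ^ (-θ) * fBes θ t with hW
  have hcont : ContinuousWithinAt W (Ici 1) 1 := by
    refine ContinuousOn.continuousWithinAt (s := Ici (1 : ℝ)) ?_ self_mem_Ici
    refine ContinuousOn.sub (ContinuousOn.comp (g := fBes θ)
      (f := fun t : ℝ => r - r * (r - 1) * (r + t - 1)⁻¹) (continuousOn_fBes hθ) ?_ ?_)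
      (ContinuousOn.mul (ContinuousOn.mul continuousOn_const ?_) (continuousOn_fBes hθ))
    · refine continuousOn_const.sub (continuousOn_const.mul (ContinuousOn.inv₀ (by fun_prop) ?_))
      intro t (ht : 1 ≤ t)
      linarith
    · intro t (ht : 1 ≤ t)
      simp only [mem_Ici]
      rw [hσ1 t ht]
      have h1 : 0 ≤ t - 1 := by linarith
      have h2 : 0 < r + t - 1 := by linarith
      have : 0 ≤ (r - 1) * (t - 1) * (r + t - 1)⁻¹ := by positivity
      linarith
    · refine ContinuousOn.rpow_const (by fun_prop) ?_
      intro t (ht : 1 ≤ t)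
      left
      linarith
  have hderiv : ∀ t ∈ Ioi (1 : ℝ), HasDerivAt W
      (θ * (r - 1) ^ θ * ((r + t - 1) ^ (-θ - 1) * fBes θ t)) t := by
    intro t (ht : 1 < t)
    have ht0 : 0 < t := by linarith
    have ht1 : 0 < t - 1 := by linarith
    have hD : 0 < r + t - 1 := by linarith
    have hDd : HasDerivAt (fun t : ℝ => r + t - 1) 1 t :=
      ((hasDerivAt_id t).const_add r).sub_const 1
    have hσd : HasDerivAt (fun t : ℝ => r - r * (r - 1) * (r + t - 1)⁻¹)
        (-(r * (r - 1) * (-1 / (r + t - 1) ^ 2))) t :=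
      ((hDd.fun_inv hD.ne').const_mul _).const_sub _
    have hσgt : 1 < r - r * (r - 1) * (r + t - 1)⁻¹ := by
      rw [hσ1 t ht.le]
      have : 0 < (r - 1) * (t - 1) * (r + t - 1)⁻¹ := by positivity
      linarith
    have hA := (hasDerivAt_fBes hθ hσgt).comp t hσd
    have hB := ((hDd.rpow_const (p := -θ) (Or.inl hD.ne')).const_mul ((r - 1) ^ θ)).mul
      (hasDerivAt_fBes hθ ht)
    convert! hA.sub hB using 1
    have e1 : r - r * (r - 1) * (r + t - 1)⁻¹ = r * t * (r + t - 1)⁻¹ := by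
      field_simp
      ring
    rw [show r - r * (r - 1) * (r + t - 1)⁻¹ - 1 = (r - 1) * (t - 1) * (r + t - 1)⁻¹ by
        rw [hσ1 t ht.le]; ring, e1, mul_rpow (by positivity) (by positivity),
      mul_rpow hr1.le ht1.le, inv_rpow hD.le, rpow_sub_one hr1.ne',
      rpow_sub_one hD.ne' θ, rpow_sub_one hD.ne' (-θ), rpow_neg hD.le]
    have := (rpow_pos_of_pos hD θ).ne'
    field_simp
    ring
  have hD : Tendsto (fun t : ℝ => r + t - 1) atTop atTop :=
    tendsto_atTop_add_const_right _ _ (tendsto_atTop_add_const_left _ _ tendsto_id)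
  have hlim : Tendsto W atTop (𝓝 (fBes θ r)) := by
    have h1 : Tendsto (fun t : ℝ => r - r * (r - 1) * (r + t - 1)⁻¹) atTop (𝓝 r) := by
      simpa using ((tendsto_inv_atTop_zero.comp hD).const_mul (r * (r - 1))).const_sub r
    have h2 := (hasDerivAt_fBes hθ hr).continuousAt.tendsto.comp h1
    have h3 : Tendsto (fBes θ) atTop (𝓝 0) := by
      have h : Tendsto (fun s : ℝ => s - 1) atTop atTop :=
        tendsto_atTop_add_const_right _ (-1 : ℝ) tendsto_id
      have := (tendsto_integral_Ioi_zero (μ := volume)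
        (f := fun t : ℝ => t ^ (θ - 1) * (t + 1)⁻¹) h).const_mul (Real.sin (π * θ) / π)
      rwa [mul_zero] at this
    have h4 := (((tendsto_rpow_neg_atTop hθ.1).comp hD).const_mul ((r - 1) ^ θ)).mul h3
    simpa using h2.sub h4
  have key := integral_Ioi_of_hasDerivAt_of_nonneg hcont hderiv (fun t (ht : 1 < t) => by
    have h1 := (fBes_mem_Icc hθ ht.le).1
    have h2 : 0 < r + t - 1 := by linarith
    have h3 := hθ.1
    positivity) hlim
  rw [integral_const_mul] at key
  rw [key, hW]
  simp only
  rw [hσ1 1 le_rfl, sub_self, mul_zero, zero_mul, add_zero, fBes_one hθ, add_sub_cancel_right,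
    mul_one]

theorem S_of_eq {θ s : ℝ} (hθ : 0 < θ) (hs : 0 < s) (F : ℝ × ℝ → ℝ) : S θ F (s, s) = 1 := by
  simp [S, div_self hs.ne', zero_rpow hθ.ne']

theorem S_fBes_ratio {θ : ℝ} (hθ : θ ∈ Ioo (0 : ℝ) 1) {p : ℝ × ℝ} (hp : p ∈ Ile) :
    S θ (fun q : ℝ × ℝ => fBes θ (q.2 / q.1)) p = fBes θ (p.2 / p.1) := by
  obtain ⟨s₁, s₂⟩ := p
  obtain ⟨h0, h1⟩ : 0 < s₁ ∧ s₁ ≤ s₂ := hp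
  rcases h1.eq_or_lt with rfl | h1
  · rw [S_of_eq hθ.1 h0, div_self h0.ne', fBes_one hθ]
  have hr : 1 < s₂ / s₁ := (one_lt_div h0).2 h1
  have hd : s₂ - s₁ ≠ 0 := (sub_pos.2 h1).ne'
  have hcongr : ∀ t : ℝ, (s₂ - s₁) / ((s₂ - s₁) / t) = t := fun t => div_div_cancel₀ hd
  simp only [S, hcongr]
  rw [integral_rpow_mul_fBes hθ hr, show 1 - s₁ / s₂ = (s₂ / s₁ - 1) / (s₂ / s₁) by
      have := h0.trans h1
      field_simp,
    div_rpow (by linarith) (by linarith), rpow_neg (by linarith)]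
  ring

/-- The integral part of `S` contracts the weight `t ^ (-α)`. -/
theorem integral_rpow_mul_rpow_le {θ α r : ℝ} (hθ : θ ∈ Ioo (0 : ℝ) 1)
    (hα : α ∈ Ioo (0 : ℝ) (1 - θ)) (hr : 1 < r) :
    θ * (r - 1) ^ θ * ∫ t in Ioi (1 : ℝ), (r + t - 1) ^ (-θ - 1) * t ^ (-α) ≤
      θ * beta (1 - α) (θ + α) * r ^ (-α) := by
  obtain ⟨h0, h1⟩ := hθ
  obtain ⟨hα0, hα1⟩ := hα
  have hr0 : 0 < r := by linarith
  have himage : (fun v : ℝ => r * v + 1) '' Ioi 0 = Ioi 1 := by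
    ext x
    simp only [mem_image, mem_Ioi]
    constructor
    · rintro ⟨v, hv, rfl⟩
      have := mul_pos hr0 hv
      linarith
    · intro hx
      exact ⟨(x - 1) / r, div_pos (by linarith) hr0, by field_simp; ring⟩
  have hderiv : ∀ v ∈ Ioi (0 : ℝ), HasDerivWithinAt (fun v : ℝ => r * v + 1) r (Ioi 0) v :=
    fun v _ => by
      simpa using (((hasDerivAt_id v).const_mul r).add_const 1).hasDerivWithinAt (s := Ioi 0)
  have hinj : InjOn (fun v : ℝ => r * v + 1) (Ioi 0) := fun x _ y _ h =>
    mul_left_cancel₀ hr0.ne' (add_right_cancel h)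
  have hle : ∫ t in Ioi (1 : ℝ), (r + t - 1) ^ (-θ - 1) * t ^ (-α) ≤
      r ^ (-θ) * r ^ (-α) * beta (1 - α) (θ + α) := by
    rw [← himage, integral_image_eq_integral_abs_deriv_smul measurableSet_Ioi hderiv hinj,
      ← integral_Ioi_rpow_mul_add_one_rpow (by linarith) (by linarith), ← integral_const_mul]
    refine integral_mono_of_nonneg (ae_restrict_of_forall_mem measurableSet_Ioi ?_)
      ((integrableOn_Ioi_rpow_mul_add_one_rpow (by linarith) (by linarith)).const_mul _)
      (ae_restrict_of_forall_mem measurableSet_Ioi ?_)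
    · intro v (hv : 0 < v)
      have : 0 < r + (r * v + 1) - 1 := by nlinarith
      simp only [Pi.zero_apply, smul_eq_mul]
      positivity
    · intro v (hv : 0 < v)
      have hv1 : 0 < v + 1 := by linarith
      have hrv : 0 < r * v := mul_pos hr0 hv
      simp only [smul_eq_mul]
      rw [abs_of_pos hr0, show r + (r * v + 1) - 1 = r * (v + 1) by ring,
        mul_rpow hr0.le hv1.le, show -(1 - α + (θ + α)) = -θ - 1 by ring,
        show 1 - α - 1 = -α by ring, rpow_sub_one hr0.ne' (-θ)]
      have hb : (r * v + 1) ^ (-α) ≤ r ^ (-α) * v ^ (-α) := by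
        rw [← mul_rpow hr0.le hv.le]
        exact rpow_le_rpow_of_nonpos hrv (by linarith) (by linarith)
      calc r * (r ^ (-θ) / r * (v + 1) ^ (-θ - 1) * (r * v + 1) ^ (-α))
          = r ^ (-θ) * (v + 1) ^ (-θ - 1) * (r * v + 1) ^ (-α) := by field_simp
        _ ≤ r ^ (-θ) * (v + 1) ^ (-θ - 1) * (r ^ (-α) * v ^ (-α)) := by gcongr
        _ = _ := by ring
  have hrθ : (r - 1) ^ θ * r ^ (-θ) ≤ 1 := by
    rw [rpow_neg hr0.le, ← div_eq_mul_inv, ← div_rpow (by linarith) hr0.le]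
    exact rpow_le_one (div_nonneg (by linarith) hr0.le) ((div_le_one hr0).2 (by linarith)) h0.le
  have hbeta := beta_pos (show 0 < 1 - α by linarith) (show 0 < θ + α by linarith)
  have hr1 : 0 < r - 1 := by linarith
  calc _ ≤ θ * (r - 1) ^ θ * (r ^ (-θ) * r ^ (-α) * beta (1 - α) (θ + α)) := by gcongr
    _ = (r - 1) ^ θ * r ^ (-θ) * (θ * beta (1 - α) (θ + α) * r ^ (-α)) := by ring
    _ ≤ 1 * (θ * beta (1 - α) (θ + α) * r ^ (-α)) := by gcongr
    _ = _ := one_mul _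

theorem div_sub_mem_Ile {s₁ s₂ t : ℝ} (h : s₁ < s₂) (ht : 1 < t) :
    ((s₂ - s₁) / t, s₂ - s₁) ∈ Ile :=
  ⟨div_pos (sub_pos.2 h) (by linarith), div_le_self (sub_pos.2 h).le ht.le⟩

theorem integrableOn_S_integrand {θ : ℝ} (hθ : 0 < θ) {F : ℝ × ℝ → ℝ} (hF : Measurable F)
    (hF1 : ∀ p ∈ Ile, F p ∈ Icc (0 : ℝ) 1) {s₁ s₂ : ℝ} (h0 : 0 < s₁) (h : s₁ < s₂) :
    IntegrableOn (fun t : ℝ =>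
      (s₂ / s₁ + t - 1) ^ (-θ - 1) * F ((s₂ - s₁) / t, s₂ - s₁)) (Ioi 1) := by
  have hr : 1 < s₂ / s₁ := (one_lt_div h0).2 h
  have hK : IntegrableOn (fun t : ℝ => (s₂ / s₁ + t - 1) ^ (-θ - 1)) (Ioi 1) := by
    have := integrableOn_add_rpow_Ioi_of_lt (a := -θ - 1) (c := 1) (m := s₂ / s₁ - 1)
      (by linarith) (by linarith)
    refine this.congr_fun (fun t _ => ?_) measurableSet_Ioi
    ring_nf
  refine Integrable.mul_bdd (c := 1) hK
    (hF.comp (by fun_prop : Measurable fun t : ℝ =>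
      ((s₂ - s₁) / t, s₂ - s₁))).aestronglyMeasurable ?_
  refine ae_restrict_of_forall_mem measurableSet_Ioi fun t ht => ?_
  have := hF1 _ (div_sub_mem_Ile h ht)
  rw [norm_of_nonneg this.1]
  exact this.2

/-- If `|F - G|` is bounded by `M` in the weighted norm, then `|S F - S G|` is bounded by
`θ * B(1 - α, θ + α) * M`. -/
theorem abs_S_sub_S_le {θ α M : ℝ} (hθ : θ ∈ Ioo (0 : ℝ) 1) (hα : α ∈ Ioo (0 : ℝ) (1 - θ))
    {F G : ℝ × ℝ → ℝ} (hF : Measurable F) (hG : Measurable G)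
    (hF1 : ∀ p ∈ Ile, F p ∈ Icc (0 : ℝ) 1) (hG1 : ∀ p ∈ Ile, G p ∈ Icc (0 : ℝ) 1) (hM : 0 ≤ M)
    (hFG : ∀ p ∈ Ile, |F p - G p| ≤ M * (p.2 / p.1) ^ (-α)) {p : ℝ × ℝ} (hp : p ∈ Ile) :
    |S θ F p - S θ G p| ≤ θ * beta (1 - α) (θ + α) * M * (p.2 / p.1) ^ (-α) := by
  obtain ⟨s₁, s₂⟩ := p
  obtain ⟨h0, h1⟩ : 0 < s₁ ∧ s₁ ≤ s₂ := hp
  have hθ0 := hθ.1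
  rcases h1.eq_or_lt with rfl | h1
  · have hbeta := beta_pos (show 0 < 1 - α by linarith [hα.2, hθ.1]) (show 0 < θ + α by linarith [hα.1])
    rw [S_of_eq hθ0 h0, S_of_eq hθ0 h0, sub_self, abs_zero]
    positivity
  have hr : 1 < s₂ / s₁ := (one_lt_div h0).2 h1
  have hr1 : 0 < s₂ / s₁ - 1 := sub_pos.2 hr
  have hint : IntegrableOn (fun t : ℝ => (s₂ / s₁ + t - 1) ^ (-θ - 1) * t ^ (-α)) (Ioi 1) := by
    have hK : IntegrableOn (fun t : ℝ => (s₂ / s₁ + t - 1) ^ (-θ - 1)) (Ioi 1) := by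
      simpa using integrableOn_S_integrand hθ0 (F := fun _ => 1) measurable_const (by simp) h0 h1
    refine Integrable.mul_bdd (c := 1) hK (by fun_prop) ?_
    refine ae_restrict_of_forall_mem measurableSet_Ioi fun t (ht : 1 < t) => ?_
    rw [norm_of_nonneg (by positivity)]
    exact rpow_le_one_of_one_le_of_nonpos ht.le (by linarith [hα.1])
  have hbound : ‖∫ t in Ioi (1 : ℝ), ((s₂ / s₁ + t - 1) ^ (-θ - 1) * F ((s₂ - s₁) / t, s₂ - s₁) -
      (s₂ / s₁ + t - 1) ^ (-θ - 1) * G ((s₂ - s₁) / t, s₂ - s₁))‖ ≤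
      ∫ t in Ioi (1 : ℝ), M * ((s₂ / s₁ + t - 1) ^ (-θ - 1) * t ^ (-α)) := by
    refine norm_integral_le_of_norm_le (hint.const_mul M)
      (ae_restrict_of_forall_mem measurableSet_Ioi fun t (ht : 1 < t) => ?_)
    have hK : 0 < (s₂ / s₁ + t - 1) ^ (-θ - 1) := rpow_pos_of_pos (by linarith) _
    have := hFG _ (div_sub_mem_Ile h1 ht)
    simp only [div_div_cancel₀ (sub_pos.2 h1).ne'] at this
    rw [← mul_sub, norm_mul, norm_of_nonneg hK.le, Real.norm_eq_abs, mul_left_comm]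
    gcongr
  rw [integral_sub (integrableOn_S_integrand hθ0 hF hF1 h0 h1)
    (integrableOn_S_integrand hθ0 hG hG1 h0 h1), integral_const_mul, Real.norm_eq_abs] at hbound
  simp only [S]
  rw [add_sub_add_left_eq_sub, ← mul_sub, abs_mul, abs_of_nonneg (by positivity)]
  calc _ ≤ θ * (s₂ / s₁ - 1) ^ θ *
        (M * ∫ t in Ioi (1 : ℝ), (s₂ / s₁ + t - 1) ^ (-θ - 1) * t ^ (-α)) := by gcongr
    _ = M * (θ * (s₂ / s₁ - 1) ^ θ *
        ∫ t in Ioi (1 : ℝ), (s₂ / s₁ + t - 1) ^ (-θ - 1) * t ^ (-α)) := by ring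
    _ ≤ M * (θ * beta (1 - α) (θ + α) * (s₂ / s₁) ^ (-α)) :=
      mul_le_mul_of_nonneg_left (integral_rpow_mul_rpow_le hθ hα hr) hM
    _ = _ := by ring

theorem eq_of_S_eq_self {θ α : ℝ} (hθ : θ ∈ Ioo (0 : ℝ) 1) (hα : α ∈ Ioo (0 : ℝ) (1 - θ))
    {F G : ℝ × ℝ → ℝ} (hF : MemG α F) (hG : MemG α G) (hSF : ∀ p ∈ Ile, S θ F p = F p)
    (hSG : ∀ p ∈ Ile, S θ G p = G p) {p : ℝ × ℝ} (hp : p ∈ Ile) : F p = G p := by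
  obtain ⟨hF, hF1, CF, hCF⟩ := hF
  obtain ⟨hG, hG1, CG, hCG⟩ := hG
  have hbeta := beta_pos (show 0 < 1 - α by linarith [hα.2, hθ.1])
    (show 0 < θ + α by linarith [hα.1, hθ.1])
  have hρ0 : 0 ≤ θ * beta (1 - α) (θ + α) := (mul_pos hθ.1 hbeta).le
  have hweight : ∀ (H : ℝ × ℝ → ℝ) (C : ℝ),
      C ∈ upperBounds ((fun p : ℝ × ℝ => (p.2 / p.1) ^ α * |H p|) '' Ile) →
      ∀ q ∈ Ile, |H q| ≤ C * (q.2 / q.1) ^ (-α) := by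
    intro H C hC q hq
    have hq0 : 0 < q.2 / q.1 := div_pos (hq.1.trans_le hq.2) hq.1
    rw [rpow_neg hq0.le, ← div_eq_mul_inv, le_div_iff₀' (rpow_pos_of_pos hq0 α)]
    exact hC ⟨q, hq, rfl⟩
  have hbound : ∀ n : ℕ, ∀ q ∈ Ile, |F q - G q| ≤
      (θ * beta (1 - α) (θ + α)) ^ n * |CF + CG| * (q.2 / q.1) ^ (-α) := by
    intro n
    induction n with
    | zero =>
      intro q hq
      have hq0 : 0 < q.2 / q.1 := div_pos (hq.1.trans_le hq.2) hq.1
      calc |F q - G q| ≤ |F q| + |G q| := abs_sub _ _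
        _ ≤ CF * (q.2 / q.1) ^ (-α) + CG * (q.2 / q.1) ^ (-α) :=
          add_le_add (hweight F CF hCF q hq) (hweight G CG hCG q hq)
        _ = (CF + CG) * (q.2 / q.1) ^ (-α) := by ring
        _ ≤ |CF + CG| * (q.2 / q.1) ^ (-α) := by
          gcongr
          exact le_abs_self _
        _ = _ := by ring
    | succ n ih =>
      intro q hq
      have := abs_S_sub_S_le hθ hα hF hG hF1 hG1 (by positivity) ih hq
      rw [hSF q hq, hSG q hq] at this
      rwa [pow_succ', mul_assoc _ (_ ^ n)]
  have hlim := ((tendsto_pow_atTop_nhds_zero_of_lt_one hρ0 (mul_beta_lt_one hθ hα)).mul_const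
    |CF + CG|).mul_const ((p.2 / p.1) ^ (-α))
  rw [zero_mul, zero_mul] at hlim
  have := ge_of_tendsto' hlim fun n => hbound n p hp
  exact sub_eq_zero.1 (abs_nonpos_iff.1 this)

/-- For `θ ∈ (0,1)` and `α ∈ (0, 1−θ)`, the function
`F(s₁,s₂) = f_Bes(s₂/s₁)` belongs to `G_α`, satisfies `S F = F` on `I_≤*`, and any
`G ∈ G_α` with `S G = G` on `I_≤*` agrees with `F` almost everywhere on `I_≤*`.
In particular the unique fixed point of `S` in `G_α` is a function of the ratio
`s₂/s₁` alone. -/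
theorem S_fixed_point_is_fBes_of_ratio (θ α : ℝ) (hθ : θ ∈ Ioo (0 : ℝ) 1)
    (hα : α ∈ Ioo (0 : ℝ) (1 - θ)) :
    MemG α (fun p : ℝ × ℝ => fBes θ (p.2 / p.1)) ∧
      (∀ p ∈ Ile, S θ (fun q : ℝ × ℝ => fBes θ (q.2 / q.1)) p = fBes θ (p.2 / p.1)) ∧
      ∀ G : ℝ × ℝ → ℝ, MemG α G → (∀ p ∈ Ile, S θ G p = G p) →
        ∀ᵐ p ∂(volume.restrict Ile), G p = fBes θ (p.2 / p.1) := by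
  have hmem := memG_fBes_ratio hθ hα
  refine ⟨hmem, fun p hp => S_fBes_ratio hθ hp, fun G hG hSG => ?_⟩
  have hIle : MeasurableSet Ile :=
    (measurableSet_lt measurable_const measurable_fst).inter
      (measurableSet_le measurable_fst measurable_snd)
  exact ae_restrict_of_forall_mem hIle fun p hp =>
    eq_of_S_eq_self hθ hα hG hmem hSG (fun q hq => S_fBes_ratio hθ hq) hp
end
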